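/- Consider the fair division instance with 5 agents and 7 goods {g_1,…,g_7}, where for i ∈ {1,2,3}: v_i(g_i) = 3/4, v_i(g_4) = 3/4, and v_i(g_j) = 0 for all other goods j; agent 4 values g_1,g_2,g_3,g_4 at 7/10 each, g_5 and g_7 at 2/3 each, and g_6 at 0; agent 5 values g_1,g_2,g_3,g_4 at 7/10 each, g_6 and g_7 at 2/3 each, and g_5 at 0. Then every integral allocation x in which g_i goes to agent i for i ∈ {1,2,3}, g_4 goes to one of the agents {1,2,3}, g_5 goes to agent 4, g_6 goes to agent 5, and g_7 goes to agent 4 or agent 5, fails to be EF1. -/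

import Mathlib

open Finset

/-- The bundle of agent `k` under the integral allocation `a`. -/
def bundle {n m : ℕ} (a : Fin m → Fin n) (k : Fin n) : Finset (Fin m) :=
  Finset.univ.filter (fun j => a j = k)

/-- Envy-freeness up to one good (real valuations). -/
def EF1R {n m : ℕ} (v : Fin n → Fin m → ℝ) (a : Fin m → Fin n) : Prop :=
  ∀ i k : Fin n, (∑ j ∈ bundle a k, v i j) ≤ (∑ j ∈ bundle a i, v i j) ∨
    ∃ j ∈ bundle a k, (∑ j' ∈ (bundle a k).erase j, v i j') ≤ ∑ j ∈ bundle a i, v i j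

/-- The 5-agent, 7-good instance rounding whose spending-restricted equilibrium always
violates EF1. Agents `0, 1, 2` value their own good and good `3` at `3/4`; agents `3, 4`
value goods `0, …, 3` at `7/10`, good `6` at `2/3`, and (respectively) good `4` / good `5`
at `2/3`, everything else at `0`. -/
noncomputable def vSR : Fin 5 → Fin 7 → ℝ := fun i j =>
  if i.val < 3 then (if j.val = i.val ∨ j.val = 3 then 3 / 4 else 0)
  else if j.val ≤ 3 then 7 / 10
  else if j.val = 6 then 2 / 3
  else if (i.val = 3 ∧ j.val = 4) ∨ (i.val = 4 ∧ j.val = 5) then 2 / 3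
  else 0

/-- An agent holding a single good of nonnegative value that it values less than each of the
two goods in another bundle envies that bundle by more than one good. -/
theorem not_EF1R_of_bundle_eq {n m : ℕ} {v : Fin n → Fin m → ℝ} {a : Fin m → Fin n}
    {i k : Fin n} {c p q : Fin m} (hi : bundle a i = {c}) (hk : bundle a k = {p, q})
    (hpq : p ≠ q) (hc : 0 ≤ v i c) (hp : v i c < v i p) (hq : v i c < v i q) :
    ¬ EF1R v a := by
  intro h
  rcases h i k with h | ⟨j, hj, h⟩
  · rw [hi, hk, sum_pair hpq, sum_singleton] at h
    linarith
  · have hsum := sum_erase_add (bundle a k) (v i) hj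
    rw [hk, sum_pair hpq] at hsum
    rw [hi, hk, sum_singleton] at h
    rw [hk, mem_insert, mem_singleton] at hj
    rcases hj with rfl | rfl <;> linarith

/-- Every rounding of the spending-restricted equilibrium allocation (good `i` to agent `i`
for `i ∈ {0,1,2}`, good `3` to one of the agents `{0,1,2}`, good `4` to agent `3`, good `5`
to agent `4`, good `6` to agent `3` or `4`) violates EF1. -/
theorem sr_rounding_not_ef1 (a : Fin 7 → Fin 5)
    (h0 : a 0 = 0) (h1 : a 1 = 1) (h2 : a 2 = 2)
    (h3 : (a 3).val < 3) (h4 : a 4 = 3) (h5 : a 5 = 4)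
    (h6 : a 6 = 3 ∨ a 6 = 4) :
    ¬ EF1R vSR a := by
  obtain ⟨i, c, hi, hc, hv⟩ : ∃ i : Fin 5, ∃ c : Fin 7, bundle a i = {c} ∧ vSR i c = 2 / 3 ∧
      ∀ p : Fin 7, p ≤ 3 → vSR i p = 7 / 10 := by
    rcases h6 with h6 | h6
    · refine ⟨4, 5, ?_, by simp [vSR], fun p hp => ?_⟩
      · ext j
        fin_cases j <;> simp_all [bundle]
        lia
      · simp_all [vSR, Fin.le_def]
    · refine ⟨3, 4, ?_, by simp [vSR], fun p hp => ?_⟩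
      · ext j
        fin_cases j <;> simp_all [bundle]
        lia
      · simp_all [vSR, Fin.le_def]
  obtain ⟨p, hp, hk⟩ : ∃ p : Fin 7, p < 3 ∧ bundle a (a 3) = {p, 3} := by
    have hcases : a 3 = 0 ∨ a 3 = 1 ∨ a 3 = 2 := by lia
    rcases hcases with h | h | h
    · refine ⟨0, by decide, ?_⟩
      ext j
      fin_cases j <;> rcases h6 with h6 | h6 <;> simp_all [bundle]
    · refine ⟨1, by decide, ?_⟩
      ext j
      fin_cases j <;> rcases h6 with h6 | h6 <;> simp_all [bundle]
    · refine ⟨2, by decide, ?_⟩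
      ext j
      fin_cases j <;> rcases h6 with h6 | h6 <;> simp_all [bundle]
  refine not_EF1R_of_bundle_eq hi hk hp.ne ?_ ?_ ?_
  · norm_num [hc]
  · norm_num [hc, hv p hp.le]
  · norm_num [hc, hv 3 le_rfl]
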